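/- The Gauss hypergeometric series satisfies ₂F₁(1/3, 2/3; 7/6; 5/32) = (1/20) · √3 · Γ(1/3)⁶ / π³, where Γ denotes the Gamma function. -/

import Mathlib

open scoped Nat

/-- Pochhammer symbol (rising factorial) on the reals. -/
noncomputable def poch (a : ℝ) (n : ℕ) : ℝ := ∏ i ∈ Finset.range n, (a + i)

/-- Gauss hypergeometric series ₂F₁(a,b;c;x) as a real series. -/
noncomputable def twoFone (a b c x : ℝ) : ℝ :=
  ∑' n : ℕ, poch a n * poch b n / (poch c n * (n ! : ℝ)) * x ^ n

open MeasureTheory Set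

lemma poch_succ (a : ℝ) (n : ℕ) : poch a (n+1) = poch a n * (a + n) := by
  simp [poch, Finset.prod_range_succ]

lemma poch_pos {a : ℝ} (ha : 0 < a) (n : ℕ) : 0 < poch a n :=
  Finset.prod_pos fun i _ => by positivity

lemma poch_mono {a b : ℝ} (ha : 0 < a) (hab : a ≤ b) (n : ℕ) : poch a n ≤ poch b n :=
  Finset.prod_le_prod (fun i _ => by positivity) fun i _ => by linarith

lemma poch_one (n : ℕ) : poch 1 n = n ! := by
  induction n with
  | zero => simp [poch]
  | succ n ih => rw [poch_succ, ih, Nat.factorial_succ]; push_cast; ring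

lemma Gamma_poch {a : ℝ} (ha : 0 < a) (n : ℕ) : Real.Gamma (a + n) = poch a n * Real.Gamma a := by
  induction n with
  | zero => simp [poch]
  | succ n ih =>
    rw [poch_succ]; push_cast
    rw [← add_assoc, Real.Gamma_add_one (by positivity), ih]; ring

lemma choose_poch (a : ℝ) (n : ℕ) : Ring.choose (a + n - 1) n = poch a n / n ! := by
  have h := Ring.factorial_nsmul_multichoose_eq_ascPochhammer a n
  have h2 : Ring.choose (a + n - 1) n = Ring.multichoose a n := by
    rw [Ring.choose]; congr 1; ring
  have h3 : ∀ n : ℕ, (ascPochhammer ℕ n).smeval a = poch a n := by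
    intro n
    rw [Polynomial.ascPochhammer_smeval_eq_eval]
    induction n with
    | zero => simp [poch]
    | succ n ih => rw [ascPochhammer_succ_eval, poch_succ, ih]
  rw [h2, eq_div_iff (by positivity), ← h3, ← h, nsmul_eq_mul, mul_comm]

lemma binom_hasSum (a x : ℝ) (h0 : 0 ≤ x) (h1 : x < 1) :
    HasSum (fun n => poch a n / n ! * x ^ n) ((1 - x) ^ (-a)) := by
  have h := (Real.one_div_one_sub_rpow_hasFPowerSeriesOnBall_zero a).hasSum (y := x)
    (by simp [abs_of_nonneg h0, h1, edist_dist])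
  simp only [zero_add] at h
  rw [Real.rpow_neg (by linarith), ← one_div]
  have e : (fun n : ℕ => poch a n / n ! * x ^ n) = fun n => (FormalMultilinearSeries.ofScalars ℝ (fun n : ℕ => Ring.choose (a + n - 1) n) n) fun _ => x := by
    ext n
    rw [FormalMultilinearSeries.ofScalars_apply_eq, choose_poch, smul_eq_mul]
  rw [e]; exact h

lemma beta_int {a b : ℝ} (ha : 0 < a) (hb : 0 < b) :
    IntegrableOn (fun t : ℝ => t ^ (a-1) * (1-t) ^ (b-1)) (Ioo 0 1) ∧
    ∫ t in Ioo (0:ℝ) 1, t ^ (a-1) * (1-t) ^ (b-1) = Real.Gamma a * Real.Gamma b / Real.Gamma (a+b) := by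
  have hc := Complex.betaIntegral_convergent (u := a) (v := b) (by simpa) (by simpa)
  rw [intervalIntegrable_iff_integrableOn_Ioo_of_le zero_le_one] at hc
  have hE : EqOn (fun t : ℝ => (t:ℂ) ^ ((a:ℂ) - 1) * (1 - (t:ℂ)) ^ ((b:ℂ) - 1))
      (fun t : ℝ => ((t ^ (a-1) * (1-t) ^ (b-1) : ℝ) : ℂ)) (Ioo 0 1) := by
    intro t ht
    simp only
    rw [Complex.ofReal_mul, Complex.ofReal_cpow ht.1.le, Complex.ofReal_cpow (by linarith [ht.2])]
    push_cast; rfl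
  have hI : IntegrableOn (fun t : ℝ => t ^ (a-1) * (1-t) ^ (b-1)) (Ioo 0 1) := by
    have := (hc.congr_fun hE measurableSet_Ioo).re
    simpa using! this
  refine ⟨hI, ?_⟩
  have := ProbabilityTheory.beta_eq_betaIntegralReal a b ha hb
  rw [ProbabilityTheory.beta] at this
  rw [this, Complex.betaIntegral, intervalIntegral.integral_of_le zero_le_one,
    integral_Ioc_eq_integral_Ioo, setIntegral_congr_fun measurableSet_Ioo hE, integral_complex_ofReal, Complex.ofReal_re]

lemma euler : HasSum (fun n : ℕ => poch (1/3) n * poch (2/3) n / (poch (7/6) n * (n ! : ℝ)) * (5/32) ^ n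
      * (Real.Gamma (2/3) * Real.Gamma (1/2) / Real.Gamma (7/6)))
    (∫ t in Ioo (0:ℝ) 1, t ^ (-(1/3) : ℝ) * (1-t) ^ (-(1/2) : ℝ) * (1 - 5/32*t) ^ (-(1/3) : ℝ)) := by
  let F : ℕ → ℝ → ℝ := fun n t => poch (1/3) n / n ! * (5/32)^n * (t ^ (((2/3:ℝ)+n) - 1) * (1-t) ^ ((1/2:ℝ)-1))
  have hb : ∀ n : ℕ, _ := fun n => beta_int (a := 2/3 + n) (b := 1/2) (by positivity) (by norm_num)
  have hFi : ∀ n, Integrable (F n) (volume.restrict (Ioo 0 1)) := fun n => (hb n).1.const_mul _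
  have hFv : ∀ n, ∫ t in Ioo (0:ℝ) 1, F n t = poch (1/3) n * poch (2/3) n / (poch (7/6) n * (n ! : ℝ)) * (5/32) ^ n
      * (Real.Gamma (2/3) * Real.Gamma (1/2) / Real.Gamma (7/6)) := by
    intro n
    simp only [F]
    rw [integral_const_mul, (hb n).2, show (2/3:ℝ) + n + 1/2 = 7/6 + n by ring, Gamma_poch (by norm_num),
      Gamma_poch (by norm_num)]
    have := (poch_pos (a := 7/6) (by norm_num) n).ne'
    have := (Real.Gamma_pos_of_pos (s := 7/6) (by norm_num)).ne'
    field_simp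
  have hFn : ∀ n, ∀ t ∈ Ioo (0:ℝ) 1, 0 ≤ F n t := by
    intro n t ht
    have := (poch_pos (a := 1/3) (by norm_num) n)
    have := ht.1
    have : 0 < 1 - t := by linarith [ht.2]
    positivity
  have hFnorm : ∀ n, ∫ t in Ioo (0:ℝ) 1, ‖F n t‖ = ∫ t in Ioo (0:ℝ) 1, F n t := fun n =>
    setIntegral_congr_fun measurableSet_Ioo fun t ht => Real.norm_of_nonneg (hFn n t ht)
  have hS : Summable fun n => ∫ t in Ioo (0:ℝ) 1, ‖F n t‖ := by
    simp_rw [hFnorm, hFv]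
    apply Summable.mul_right
    refine Summable.of_nonneg_of_le (fun n => ?_) (fun n => ?_)
      (summable_geometric_of_lt_one (r := 5/32) (by norm_num) (by norm_num))
    · have h1 := (poch_pos (a := 1/3) (by norm_num) n)
      have h2 := (poch_pos (a := 2/3) (by norm_num) n)
      have h3 := (poch_pos (a := 7/6) (by norm_num) n)
      positivity
    · have h1 := (poch_pos (a := 1/3) (by norm_num) n)
      have h2 := (poch_pos (a := 2/3) (by norm_num) n)
      have h3 := (poch_pos (a := 7/6) (by norm_num) n)
      have h4 := poch_mono (a := 1/3) (b := 1) (by norm_num) (by norm_num) n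
      have h5 := poch_mono (a := 2/3) (b := 7/6) (by norm_num) (by norm_num) n
      rw [poch_one] at h4
      refine mul_le_of_le_one_left (by positivity) ?_
      rw [div_le_one (by positivity), mul_comm]
      gcongr
  have key := hasSum_integral_of_summable_integral_norm hFi hS
  simp_rw [hFv] at key
  refine Eq.subst (motive := fun z => HasSum _ z) (Eq.symm ?_) key
  refine setIntegral_congr_fun measurableSet_Ioo fun t (ht : t ∈ Ioo (0:ℝ) 1) => ?_
  have h := (binom_hasSum (1/3) (5/32*t) (by linarith [ht.1]) (by linarith [ht.2])).mul_left
    (t ^ (-(1/3) : ℝ) * (1-t) ^ (-(1/2) : ℝ))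
  rw [← h.tsum_eq]
  congr 1; ext n
  simp only [F]
  rw [show (2/3:ℝ)+n - 1 = -(1/3) + n by ring, Real.rpow_add ht.1, Real.rpow_natCast,
    show (1/2:ℝ)-1 = -(1/2) by ring, mul_pow]
  ring

noncomputable def W (t : ℝ) : ℝ := t^2*(80+t)^3/(32-5*t)^4
noncomputable def W' (t : ℝ) : ℝ := 5*t*(80+t)^2*(1024+192*t-t^2)/(32-5*t)^5

lemma W_deriv (t : ℝ) (ht : t ≤ 1) : HasDerivAt W (W' t) t := by
  have h0 : 32 - 5*t ≠ 0 := by linarith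
  have h1 : HasDerivAt (fun t : ℝ => t^2*(80+t)^3) (2*t*(80+t)^3 + t^2*(3*(80+t)^2)) t := by
    have := ((hasDerivAt_id t).pow 2).mul (((hasDerivAt_id t).const_add 80).pow 3)
    convert! this using 1
    simp
  have h2 : HasDerivAt (fun t : ℝ => (32-5*t)^4) (4*(32-5*t)^3*(-5)) t := by
    have := (((hasDerivAt_id t).const_mul 5).const_sub 32).pow 4
    convert! this using 1
    simp
  have := h1.div h2 (pow_ne_zero 4 h0)
  convert! this using 1
  rw [W']
  field_simp
  ring

lemma W'_pos {t : ℝ} (h0 : 0 < t) (h1 : t < 1) : 0 < W' t := by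
  have : 0 < 32 - 5*t := by linarith
  have : 0 < 1024+192*t-t^2 := by nlinarith
  unfold W'; positivity

lemma W_cont : ContinuousOn W (Icc 0 1) := fun t ht => (W_deriv t ht.2).continuousAt.continuousWithinAt

lemma W_mono : StrictMonoOn W (Icc 0 1) := by
  apply strictMonoOn_of_deriv_pos (convex_Icc 0 1) W_cont
  intro t ht
  rw [interior_Icc] at ht
  rw [(W_deriv t ht.2.le).deriv]
  exact W'_pos ht.1 ht.2

lemma W_image : W '' Ioo 0 1 = Ioo 0 1 := by
  rw [W_cont.image_Ioo_of_strictMonoOn zero_le_one W_mono]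
  norm_num [W]

lemma pull {t : ℝ} (ht : t ∈ Ioo (0:ℝ) 1) :
    |W' t| * (W t ^ ((1/3:ℝ)-1) * (1 - W t) ^ ((1/2:ℝ)-1)) =
    (5 * 32 ^ (-(1/3):ℝ)) * (t ^ (-(1/3) : ℝ) * (1-t) ^ (-(1/2) : ℝ) * (1 - 5/32*t) ^ (-(1/3) : ℝ)) := by
  obtain ⟨h0, h1⟩ := ht
  have hA : 0 < 32 - 5*t := by linarith
  have hB : 0 < 1024+192*t-t^2 := by nlinarith
  have hC : 0 < 80 + t := by linarith
  have hD : 0 < 1 - t := by linarith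
  rw [abs_of_pos (W'_pos h0 h1)]
  have e1 : 1 - W t = (1-t)*(1024+192*t-t^2)^2/(32-5*t)^4 := by
    rw [W, eq_div_iff (by positivity), sub_mul, div_mul_cancel₀ _ (by positivity)]; ring
  have e2 : 1 - 5/32*t = (32-5*t)/32 := by ring
  rw [e1, e2, W, W']
  have p : ∀ (x : ℝ) (n : ℕ) (y : ℝ), 0 < x → (x^n)^y = x^((n:ℝ)*y) := fun x n y hx => by
    rw [Real.rpow_mul hx.le, Real.rpow_natCast]
  rw [Real.div_rpow (by positivity) (by positivity), Real.mul_rpow (by positivity) (by positivity),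
    Real.div_rpow (by positivity) (by positivity), Real.mul_rpow (by positivity) (by positivity),
    Real.div_rpow (by positivity) (by positivity), p _ _ _ h0, p _ _ _ hC, p _ _ _ hA, p _ _ _ hA, p _ _ _ hB]
  have q1 : t ^ (((2:ℕ):ℝ) * ((1/3:ℝ)-1)) = t^(-(1/3):ℝ) / t := by
    rw [← Real.rpow_sub_one h0.ne']; norm_num
  have q2 : (80+t) ^ (((3:ℕ):ℝ) * ((1/3:ℝ)-1)) = ((80+t)^2)⁻¹ := by
    rw [← Real.rpow_natCast, ← Real.rpow_neg hC.le]; norm_num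
  have q3 : (32-5*t) ^ (((4:ℕ):ℝ) * ((1/3:ℝ)-1)) = ((32-5*t)^(-(1/3):ℝ) * (32-5*t)^3)⁻¹ := by
    rw [← Real.rpow_natCast, ← Real.rpow_add hA, ← Real.rpow_neg hA.le]; norm_num
  have q4 : (32-5*t) ^ (((4:ℕ):ℝ) * ((1/2:ℝ)-1)) = ((32-5*t)^2)⁻¹ := by
    rw [← Real.rpow_natCast, ← Real.rpow_neg hA.le]; norm_num
  have q5 : (1024+192*t-t^2) ^ (((2:ℕ):ℝ) * ((1/2:ℝ)-1)) = (1024+192*t-t^2)⁻¹ := by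
    rw [← Real.rpow_neg_one]; norm_num
  rw [q1, q2, q3, q4, q5, show (1/2:ℝ)-1 = -(1/2) by norm_num, Real.rpow_neg (x := 32) (by norm_num)]
  have r1 := (Real.rpow_pos_of_pos hA (-(1/3))).ne'
  have r2 : (32:ℝ)^(1/3:ℝ) ≠ 0 := by positivity
  generalize (32-5*t)^(-(1/3):ℝ) = a at *
  generalize (32:ℝ)^(1/3:ℝ) = b at *
  generalize t^(-(1/3):ℝ) = c at *
  generalize (1-t)^(-(1/2):ℝ) = d at *
  generalize 32-5*t = A at *
  generalize 80+t = C at *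
  generalize 1024+192*t-t^2 = B at *
  field_simp

lemma main_int : (5 * 32 ^ (-(1/3):ℝ)) * ∫ t in Ioo (0:ℝ) 1, t ^ (-(1/3) : ℝ) * (1-t) ^ (-(1/2) : ℝ) * (1 - 5/32*t) ^ (-(1/3) : ℝ)
   = Real.Gamma (1/3) * Real.Gamma (1/2) / Real.Gamma (5/6) := by
  have h := (beta_int (a := 1/3) (b := 1/2) (by norm_num) (by norm_num)).2
  rw [show (1/3:ℝ)+1/2 = 5/6 by norm_num] at h
  rw [← h]
  conv_rhs => rw [← W_image]
  rw [integral_image_eq_integral_abs_deriv_smul measurableSet_Ioo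
    (fun t ht => (W_deriv t ht.2.le).hasDerivWithinAt) (W_mono.injOn.mono Ioo_subset_Icc_self),
    ← integral_const_mul]
  exact setIntegral_congr_fun measurableSet_Ioo fun t ht => (pull ht).symm

theorem stmt12 : twoFone (1/3) (2/3) (7/6) (5/32) = (1/20) * Real.sqrt 3 * Real.Gamma (1/3) ^ 6 / Real.pi ^ 3 := by
  have h := euler.tsum_eq
  rw [tsum_mul_right] at h
  change twoFone (1/3) (2/3) (7/6) (5/32) * _ = _ at h
  have hm := main_int
  rw [← h] at hm
  have g76 : Real.Gamma (7/6) = 1/6 * Real.Gamma (1/6) := by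
    rw [← Real.Gamma_add_one (by norm_num)]; norm_num
  have r1 := Real.Gamma_mul_Gamma_one_sub (1/6)
  have r2 := Real.Gamma_mul_Gamma_one_sub (1/3)
  have d := Real.Gamma_mul_Gamma_add_half (1/6)
  rw [show Real.pi * (1/6) = Real.pi/6 by ring, Real.sin_pi_div_six, show (1:ℝ)-1/6=5/6 by norm_num] at r1
  rw [show Real.pi * (1/3) = Real.pi/3 by ring, Real.sin_pi_div_three, show (1:ℝ)-1/3=2/3 by norm_num] at r2
  rw [show (1/6:ℝ)+1/2=2/3 by norm_num, show (2:ℝ)*(1/6) = 1/3 by norm_num, show (1:ℝ)-1/3=2/3 by norm_num] at d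
  have p1 := Real.Gamma_pos_of_pos (s := 1/3) (by norm_num)
  have p2 := Real.Gamma_pos_of_pos (s := 2/3) (by norm_num)
  have p3 := Real.Gamma_pos_of_pos (s := 1/6) (by norm_num)
  have p4 := Real.Gamma_pos_of_pos (s := 5/6) (by norm_num)
  have e32 : (32:ℝ) ^ (-(1/3):ℝ) = ((2:ℝ)^(2/3:ℝ))^2 / 8 := by
    rw [show (32:ℝ) = 2^(5:ℝ) by norm_num, show (8:ℝ) = 2^(3:ℝ) by norm_num, ← Real.rpow_natCast,
      ← Real.rpow_mul (by norm_num), ← Real.rpow_mul (by norm_num), ← Real.rpow_sub (by norm_num)]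
    norm_num
  rw [e32, g76, Real.Gamma_one_half_eq] at hm
  have c0 : (0:ℝ) < (2:ℝ)^(2/3:ℝ) := by positivity
  have q0 : 0 < √Real.pi := Real.sqrt_pos.2 Real.pi_pos
  have q2 : √Real.pi ^ 2 = Real.pi := Real.sq_sqrt Real.pi_pos.le
  have s0 : 0 < √(3:ℝ) := by positivity
  have s2 : √(3:ℝ) ^ 2 = 3 := Real.sq_sqrt (by norm_num)
  have hpi := Real.pi_pos
  generalize twoFone (1/3) (2/3) (7/6) (5/32) = F at *
  generalize (2:ℝ)^(2/3:ℝ) = c at *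
  generalize √(3:ℝ) = s at *
  generalize √Real.pi = q at *
  generalize Real.pi = P at *
  generalize Real.Gamma (1/3) = G at *
  generalize Real.Gamma (2/3) = B at *
  generalize Real.Gamma (1/6) = A at *
  generalize Real.Gamma (5/6) = E at *
  have hB : B = 2*P/(s*G) := by field_simp at r2 ⊢; linarith
  have hE : E = 2*P/A := by field_simp at r1 ⊢; linarith
  have hA : A = G^2*c*q*s/(2*P) := by rw [hB] at d; field_simp at d ⊢; linarith
  have hF : F = 8*G*A/(30*c^2*E*B) := by field_simp at hm ⊢; linarith
  have hF2 : F = 8*G^2*A^2*s/(120*c^2*P^2) := by rw [hF, hE, hB]; field_simp; ring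
  rw [hF2, hA]
  have : (G^2*c*q*s/(2*P))^2 = G^4*c^2*3/(4*P) := by
    rw [div_pow, mul_pow, mul_pow, s2, q2]; field_simp; ring
  rw [this]; field_simp; norm_num
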